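/- Deterministic part of the error (main theorem, first estimate): let u₀ : ℝ → ℝ be a 1-periodic function of class C², and let u(t,x) = ∫_ℝ u₀(x + y) dγ_t(y) be the solution of the heat equation ∂_t u = (1/2) ∂²_{xx} u with initial condition u₀ (given by Gaussian convolution). For every T > 0 there exists a constant C > 0 such that for every integer M_T ≥ 1 (with δt = T/M_T), every integer M ≥ 2 (with δx = 1/M), and every 0 ≤ n ≤ M_T, setting vⁿ = Qⁿ (u₀(x_j))_{j ∈ ℤ/M}, one has max_{j ∈ ℤ/M} |u(nδt, x_j) − vⁿ_j| ≤ C (δx²/δt) sup_{x ∈ [0,1]} |u₀''(x)|. -/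

import Mathlib

open MeasureTheory ProbabilityTheory Real Finset

noncomputable section

/-- The 1-periodic hat function associated with the node `x_k = k/M`:
the unique continuous 1-periodic function, affine on each interval between
consecutive nodes, equal to 1 at `x_k` and 0 at the other nodes. -/
def hatFn (M : ℕ) (k : ZMod M) (x : ℝ) : ℝ :=
  max 0 (1 - (M : ℝ) * |(x - (k.val : ℝ) / M) - ((round (x - (k.val : ℝ) / M) : ℤ) : ℝ)|)

/-- The piecewise linear 1-periodic interpolant of nodal values `u`. -/
def interp (M : ℕ) [NeZero M] (u : ZMod M → ℝ) (x : ℝ) : ℝ :=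
  ∑ k : ZMod M, u k * hatFn M k x

/-- Discrete `ℓ²` squared norm: `δx ∑ⱼ uⱼ²` with `δx = 1/M`. -/
def l2sq (M : ℕ) [NeZero M] (u : ZMod M → ℝ) : ℝ :=
  (1 / M : ℝ) * ∑ j : ZMod M, (u j) ^ 2

/-- Discrete `h¹` squared seminorm: `δx ∑ⱼ ((u_{j+1} - u_j)/δx)²` with `δx = 1/M`. -/
def h1sq (M : ℕ) [NeZero M] (u : ZMod M → ℝ) : ℝ :=
  (1 / M : ℝ) * ∑ j : ZMod M, ((u (j + 1) - u j) / (1 / M : ℝ)) ^ 2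

/-- The matrix `Q` with entries `Q j k = ∫ φ_k(x_j + y) dγ_{δt}(y)`, `γ_{δt}` being the
centered Gaussian measure with variance `δt`. -/
def Qmat (M : ℕ) [NeZero M] (δt : ℝ) : Matrix (ZMod M) (ZMod M) ℝ :=
  fun j k => ∫ y, hatFn M k ((j.val : ℝ) / M + y) ∂(gaussianReal 0 δt.toNNReal)

/-- The random matrix `P` with entries `P j k = φ_k(x_j + √δt G^j)`. -/
def Pmat (M : ℕ) [NeZero M] (δt : ℝ) {Ω : Type} (G : ZMod M → Ω → ℝ) (ω : Ω) :
    Matrix (ZMod M) (ZMod M) ℝ :=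
  fun j k => hatFn M k ((j.val : ℝ) / M + Real.sqrt δt * G j ω)

/-- The averaged random matrix `P̄` with entries
`P̄ j k = (1/N) ∑ₘ φ_k(x_j + √δt G^{m,j})`. -/
def Pbar (M : ℕ) [NeZero M] (δt : ℝ) (N : ℕ) {Ω : Type} (G : Fin N × ZMod M → Ω → ℝ)
    (ω : Ω) : Matrix (ZMod M) (ZMod M) ℝ :=
  fun j k => (1 / N : ℝ) * ∑ m : Fin N, hatFn M k ((j.val : ℝ) / M + Real.sqrt δt * G (m, j) ω)

/-- The sequence of averaged random matrices `P⁽ⁱ⁾` with entries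
`P⁽ⁱ⁾ j k = (1/N) ∑ₘ φ_k(x_j + √δt G^{i,m,j})`. -/
def PbarSeq (M : ℕ) [NeZero M] (δt : ℝ) (N : ℕ) {Ω : Type}
    (G : ℕ × Fin N × ZMod M → Ω → ℝ) (i : ℕ) (ω : Ω) : Matrix (ZMod M) (ZMod M) ℝ :=
  fun j k => (1 / N : ℝ) * ∑ m : Fin N, hatFn M k ((j.val : ℝ) / M + Real.sqrt δt * G (i, m, j) ω)

/-- Descending product `P^{(n-1)} ⋯ P^{(0)}` (with the convention that the empty
product is the identity matrix). -/
def prodDesc {I : Type} [Fintype I] [DecidableEq I] (P : ℕ → Matrix I I ℝ) : ℕ → Matrix I I ℝ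
  | 0 => 1
  | n + 1 => P n * prodDesc P n

/-- Descending product starting from index `a`: `prodDescFrom P a s = P^{(a+s-1)} ⋯ P^{(a)}`
(identity for `s = 0`). -/
def prodDescFrom {I : Type} [Fintype I] [DecidableEq I] (P : ℕ → Matrix I I ℝ) (a : ℕ) :
    ℕ → Matrix I I ℝ
  | 0 => 1
  | s + 1 => P (a + s) * prodDescFrom P a s

end

/-- Quantitative semi-convexity/semi-concavity. -/
def QuadBd (K : ℝ) (f : ℝ → ℝ) : Prop :=
  ∀ x y a b : ℝ, 0 ≤ a → 0 ≤ b → a + b = 1 →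
    |a * f x + b * f y - f (a * x + b * y)| ≤ K / 2 * (a * b * (x - y) ^ 2)

lemma hatFn_nonneg (M : ℕ) (k : ZMod M) (x : ℝ) : 0 ≤ hatFn M k x := le_max_left _ _

lemma hatFn_le_one (M : ℕ) (k : ZMod M) (x : ℝ) : hatFn M k x ≤ 1 := by
  unfold hatFn
  refine max_le zero_le_one ?_
  have : 0 ≤ (M : ℝ) * |(x - (k.val : ℝ) / M) - ((round (x - (k.val : ℝ) / M) : ℤ) : ℝ)| := by
    positivity
  linarith

lemma hatFn_measurable (M : ℕ) (k : ZMod M) : Measurable (hatFn M k) := by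
  unfold hatFn
  simp only [round_eq]
  have h : Measurable (fun x : ℝ => ((⌊x - (k.val : ℝ) / M + 1 / 2⌋ : ℤ) : ℝ)) := by
    have h1 : Measurable (fun x : ℝ => ⌊x - (k.val : ℝ) / M + 1 / 2⌋) :=
      Int.measurable_floor.comp (by fun_prop)
    exact (measurable_from_top (f := fun z : ℤ => (z : ℝ))).comp h1
  fun_prop

lemma hatFn_integrable (M : ℕ) (k : ZMod M) (c : ℝ) (μ : Measure ℝ) [IsProbabilityMeasure μ] :
    Integrable (fun y => hatFn M k (c + y)) μ := by
  refine Integrable.of_bound (C := 1) ?_ ?_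
  · exact ((hatFn_measurable M k).comp (measurable_const_add c)).aestronglyMeasurable
  · refine Filter.Eventually.of_forall fun y => ?_
    rw [Real.norm_eq_abs, abs_of_nonneg (hatFn_nonneg _ _ _)]
    exact hatFn_le_one _ _ _

lemma hatFn_eq (M : ℕ) [NeZero M] (hM : 2 ≤ M) (k : ZMod M) (x : ℝ) :
    hatFn M k x = (if k = ((⌊M * x⌋ : ℤ) : ZMod M) then 1 - Int.fract (M * x) else 0)
      + (if k = ((⌊M * x⌋ + 1 : ℤ) : ZMod M) then Int.fract (M * x) else 0) := by
  have hM' : (2 : ℝ) ≤ M := by exact_mod_cast hM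
  have hM0 : (0 : ℝ) < M := by linarith
  set i := ⌊M * x⌋ with hi
  set t := Int.fract (M * x) with ht
  have ht0 : 0 ≤ t := Int.fract_nonneg _
  have ht1 : t < 1 := Int.fract_lt_one _
  have hit : (i : ℝ) + t = M * x := Int.floor_add_fract _
  have hk : ((k.val : ℤ) : ZMod M) = k := by simp
  have key : ∀ z : ℤ, k = (z : ZMod M) → ∃ m : ℤ, (z : ℝ) = k.val + M * m := by
    intro z hz
    rw [← hk] at hz
    obtain ⟨m, hm⟩ := (ZMod.intCast_eq_intCast_iff_dvd_sub _ _ M).1 hz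
    refine ⟨m, ?_⟩
    have : z = k.val + M * m := by linarith
    exact_mod_cast this
  have hne : ((i : ℤ) : ZMod M) ≠ ((i + 1 : ℤ) : ZMod M) := by
    have : Fact (1 < M) := ⟨hM⟩
    push_cast
    intro h
    exact one_ne_zero (left_eq_add.1 h)
  by_cases h1 : k = (i : ZMod M)
  · have h2 : k ≠ ((i + 1 : ℤ) : ZMod M) := by rw [h1]; exact hne
    rw [if_pos h1, if_neg h2, add_zero]
    obtain ⟨m, hm⟩ := key i h1
    have e : x - (k.val : ℝ) / M = m + t / M := by
      field_simp; linarith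
    have ht2 : t / M < 1 / 2 := by
      rw [div_lt_iff₀ hM0]; linarith
    have ht3 : 0 ≤ t / M := by positivity
    have hr : round (x - (k.val : ℝ) / M) = m := by
      rw [e, round_eq, Int.floor_eq_iff]; constructor <;> linarith
    unfold hatFn
    rw [hr, e, add_sub_cancel_left, abs_of_nonneg ht3, mul_div_cancel₀ _ hM0.ne']
    exact max_eq_right (by linarith)
  · rw [if_neg h1, zero_add]
    by_cases h2 : k = ((i + 1 : ℤ) : ZMod M)
    · rw [if_pos h2]
      obtain ⟨m, hm⟩ := key (i + 1) h2
      push_cast at hm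
      have e : x - (k.val : ℝ) / M = m - (1 - t) / M := by
        field_simp; linarith
      have ht2 : (1 - t) / M ≤ 1 / 2 := by
        rw [div_le_iff₀ hM0]; linarith
      have ht3 : 0 < (1 - t) / M := by
        apply div_pos <;> linarith
      have hr : round (x - (k.val : ℝ) / M) = m := by
        rw [e, round_eq, Int.floor_eq_iff]; constructor <;> linarith
      unfold hatFn
      rw [hr, e, sub_sub_cancel_left, abs_neg, abs_of_nonneg ht3.le, mul_div_cancel₀ _ hM0.ne']
      rw [sub_sub_cancel]
      exact max_eq_right ht0
    · rw [if_neg h2]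
      unfold hatFn
      apply max_eq_left
      set r := round (x - (k.val : ℝ) / M)
      have e : (M : ℝ) * |x - (k.val : ℝ) / M - r| = |((i - k.val - M * r : ℤ) : ℝ) + t| := by
        rw [← abs_of_pos hM0, ← abs_mul, abs_of_pos hM0]
        congr 1
        push_cast
        field_simp
        linarith
      rw [e]
      have n0 : (i - k.val - M * r : ℤ) ≠ 0 := by
        intro h
        apply h1
        have : i = k.val + M * r := by linarith
        rw [this]; simp
      have n1 : (i - k.val - M * r : ℤ) ≠ -1 := by
        intro h
        apply h2
        have : i + 1 = k.val + M * r := by linarith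
        rw [this]; simp
      generalize (i - k.val - M * r : ℤ) = N at n0 n1
      rcases (by omega : 1 ≤ N ∨ N ≤ -2) with h | h
      · have : (1 : ℝ) ≤ N := by exact_mod_cast h
        have := le_abs_self ((N : ℝ) + t)
        linarith
      · have : (N : ℝ) ≤ -2 := by exact_mod_cast h
        have := neg_le_abs ((N : ℝ) + t)
        linarith

lemma interp_eq (M : ℕ) [NeZero M] (hM : 2 ≤ M) (w : ZMod M → ℝ) (x : ℝ) :
    interp M w x = (1 - Int.fract (M * x)) * w ((⌊M * x⌋ : ℤ) : ZMod M)
      + Int.fract (M * x) * w ((⌊M * x⌋ + 1 : ℤ) : ZMod M) := by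
  unfold interp
  simp only [hatFn_eq M hM, mul_add, mul_ite, mul_zero, Finset.sum_add_distrib,
    Finset.sum_ite_eq', Finset.mem_univ, if_true]
  ring

lemma node_eq (M : ℕ) [NeZero M] (f : ℝ → ℝ) (hf : Function.Periodic f 1) (z : ℤ) :
    f (((z : ZMod M).val : ℝ) / M) = f ((z : ℝ) / M) := by
  have hM0 : (M : ℝ) ≠ 0 := by exact_mod_cast NeZero.ne M
  have h : (((z : ZMod M).val : ℤ) : ZMod M) = (z : ZMod M) := by simp
  obtain ⟨m, hm⟩ := (ZMod.intCast_eq_intCast_iff_dvd_sub _ _ M).1 h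
  have e : (z : ℝ) = (z : ZMod M).val + M * m := by
    have : z = (z : ZMod M).val + M * m := by linarith
    exact_mod_cast this
  have e2 : (z : ℝ) / M = ((z : ZMod M).val : ℝ) / M + m := by
    rw [div_add' _ _ _ hM0, mul_comm (m : ℝ), ← e]
  rw [e2]
  have := hf.int_mul m (((z : ZMod M).val : ℝ) / M)
  rw [mul_one] at this
  exact this.symm

lemma interp_err (M : ℕ) [NeZero M] (hM : 2 ≤ M) (K : ℝ) (hK : 0 ≤ K) (f : ℝ → ℝ)
    (hf : Function.Periodic f 1) (hq : QuadBd K f) (x : ℝ) :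
    |f x - interp M (fun k => f ((k.val : ℝ) / M)) x| ≤ K * (1 / M : ℝ) ^ 2 := by
  have hM0 : (M : ℝ) ≠ 0 := by exact_mod_cast NeZero.ne M
  rw [interp_eq M hM, node_eq M f hf, node_eq M f hf]
  set t := Int.fract (M * x) with ht
  have ht0 : 0 ≤ t := Int.fract_nonneg _
  have ht1 : t < 1 := Int.fract_lt_one _
  have hit : (⌊M * x⌋ : ℝ) + t = M * x := Int.floor_add_fract _
  have := hq ((⌊M * x⌋ : ℤ) / M) ((⌊M * x⌋ + 1 : ℤ) / M) (1 - t) t (by linarith) ht0 (by ring)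
  have e : (1 - t) * ((⌊M * x⌋ : ℤ) / M : ℝ) + t * ((⌊M * x⌋ + 1 : ℤ) / M : ℝ) = x := by
    push_cast; field_simp; linarith
  rw [e] at this
  rw [abs_sub_comm]
  refine this.trans ?_
  have e3 : ((⌊M * x⌋ : ℤ) / M - (⌊M * x⌋ + 1 : ℤ) / M : ℝ) ^ 2 = (1 / M : ℝ) ^ 2 := by
    push_cast; ring
  rw [e3]
  have : (1 - t) * t ≤ 1 := by nlinarith
  have h4 : (1 - t) * t * (1 / M : ℝ) ^ 2 ≤ 1 * (1 / M : ℝ) ^ 2 := by gcongr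
  have h5 : 0 ≤ (1 / M : ℝ) ^ 2 := by positivity
  nlinarith [mul_le_mul_of_nonneg_left h4 (by linarith : 0 ≤ K / 2), mul_nonneg hK h5]

section avg
variable {f : ℝ → ℝ} {B : ℝ}

lemma shift_integrable (hc : Continuous f) (hB : ∀ x, |f x| ≤ B) (c : ℝ)
    (μ : Measure ℝ) [IsProbabilityMeasure μ] : Integrable (fun y => f (c + y)) μ :=
  Integrable.of_bound (C := B) (hc.comp (continuous_const_add c)).aestronglyMeasurable
    (Filter.Eventually.of_forall fun y => by rw [Real.norm_eq_abs]; exact hB _)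

lemma avg_cont (hc : Continuous f) (hB : ∀ x, |f x| ≤ B)
    (μ : Measure ℝ) [IsProbabilityMeasure μ] : Continuous (fun x => ∫ y, f (x + y) ∂μ) := by
  refine continuous_of_dominated (bound := fun _ => B) ?_ ?_ (integrable_const B) ?_
  · intro x; exact (hc.comp (continuous_const_add x)).aestronglyMeasurable
  · intro x; exact Filter.Eventually.of_forall fun y => by rw [Real.norm_eq_abs]; exact hB _
  · exact Filter.Eventually.of_forall fun y => by fun_prop

lemma abs_avg_le {g : ℝ → ℝ} (hB : ∀ x, |g x| ≤ B)
    (μ : Measure ℝ) [IsProbabilityMeasure μ] : |∫ y, g y ∂μ| ≤ B := by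
  have := norm_integral_le_of_norm_le_const (μ := μ) (f := g) (C := B)
    (Filter.Eventually.of_forall fun y => by rw [Real.norm_eq_abs]; exact hB _)
  simpa using this

lemma avg_per (hp : Function.Periodic f 1)
    (μ : Measure ℝ) : Function.Periodic (fun x => ∫ y, f (x + y) ∂μ) 1 := by
  intro x
  refine integral_congr_ae (Filter.Eventually.of_forall fun y => ?_)
  change f (x + 1 + y) = f (x + y)
  rw [add_right_comm]; exact hp _

lemma avg_quad (hc : Continuous f) (hB : ∀ x, |f x| ≤ B) {K : ℝ} (hq : QuadBd K f)
    (μ : Measure ℝ) [IsProbabilityMeasure μ] : QuadBd K (fun x => ∫ y, f (x + y) ∂μ) := by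
  intro x y a b ha hb hab
  have i1 := shift_integrable hc hB x μ
  have i2 := shift_integrable hc hB y μ
  have i3 := shift_integrable hc hB (a * x + b * y) μ
  have e : a * ∫ z, f (x + z) ∂μ + b * ∫ z, f (y + z) ∂μ - ∫ z, f (a * x + b * y + z) ∂μ
      = ∫ z, (a * f (x + z) + b * f (y + z) - f (a * x + b * y + z)) ∂μ := by
    have i4 : Integrable (fun z => a * f (x + z) + b * f (y + z)) μ :=
      (i1.const_mul a).add (i2.const_mul b)
    rw [integral_sub i4 i3, integral_add (i1.const_mul a) (i2.const_mul b), integral_const_mul, integral_const_mul]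
  change |a * ∫ z, f (x + z) ∂μ + b * ∫ z, f (y + z) ∂μ - ∫ z, f (a * x + b * y + z) ∂μ| ≤ _
  rw [e]
  refine abs_avg_le (fun z => ?_) μ
  have h := hq (x + z) (y + z) a b ha hb hab
  have e1 : a * (x + z) + b * (y + z) = a * x + b * y + z := by
    have : (a + b) * z = z := by rw [hab, one_mul]
    linarith
  have e2 : x + z - (y + z) = x - y := by ring
  rwa [e1, e2] at h

end avg

lemma quad_of_c2 (u : ℝ → ℝ) (h : ContDiff ℝ 2 u) (K : ℝ) (hK : ∀ x, |iteratedDeriv 2 u x| ≤ K) :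
    QuadBd K u := by
  have conv : ∀ s : ℝ, |s| ≤ 1 → ConvexOn ℝ Set.univ (fun x => K / 2 * x ^ 2 + s * u x) := by
    intro s hs
    have hd : Differentiable ℝ u := h.differentiable (by norm_num)
    have hd1 : ContDiff ℝ 1 (deriv u) := by
      have := (contDiff_succ_iff_deriv (n := 1) (f := u) (𝕜 := ℝ)).1 (by rw [one_add_one_eq_two]; exact h)
      exact this.2.2
    have hdd : Differentiable ℝ (deriv u) := hd1.differentiable (by norm_num)
    have e1 : deriv (fun x => K / 2 * x ^ 2 + s * u x) = fun x => K * x + s * deriv u x := by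
      funext x
      have := (((hasDerivAt_pow 2 x).const_mul (K / 2)).add ((hd x).hasDerivAt.const_mul s)).deriv
      refine this.trans ?_
      simp; ring
    have e2 : deriv (fun x => K * x + s * deriv u x) = fun x => K + s * iteratedDeriv 2 u x := by
      funext x
      have := (((hasDerivAt_id x).const_mul K).add ((hdd x).hasDerivAt.const_mul s)).deriv
      refine this.trans ?_
      rw [iteratedDeriv_succ, iteratedDeriv_one]; simp
    refine convexOn_univ_of_deriv2_nonneg (by fun_prop) (by rw [e1]; fun_prop) ?_
    intro x
    rw [Function.iterate_succ, Function.iterate_one, Function.comp, e1, e2]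
    have : |s * iteratedDeriv 2 u x| ≤ K := by
      rw [abs_mul]
      calc _ ≤ 1 * |iteratedDeriv 2 u x| := by gcongr
        _ ≤ K := by rw [one_mul]; exact hK x
    linarith [neg_le_of_abs_le this]
  intro x y a b ha hb hab
  have c1 := (conv 1 (by simp)).2 (Set.mem_univ x) (Set.mem_univ y) ha hb hab
  have c2 := (conv (-1) (by simp)).2 (Set.mem_univ x) (Set.mem_univ y) ha hb hab
  simp only [smul_eq_mul] at c1 c2
  have e : a * b * (x - y) ^ 2 = a * x ^ 2 + b * y ^ 2 - (a * x + b * y) ^ 2 := by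
    obtain rfl : b = 1 - a := by linarith
    ring
  rw [e, abs_le]
  constructor <;> linarith

lemma Q_mulVec (M : ℕ) [NeZero M] (δ : ℝ) (w : ZMod M → ℝ) (j : ZMod M) :
    (Qmat M δ).mulVec w j
      = ∫ y, interp M w ((j.val : ℝ) / M + y) ∂(gaussianReal 0 δ.toNNReal) := by
  unfold interp
  rw [integral_finsetSum _ fun k _ => (hatFn_integrable M k _ _).const_mul _]
  simp only [Matrix.mulVec, dotProduct, Qmat, integral_const_mul]
  exact Finset.sum_congr rfl fun k _ => mul_comm _ _

lemma interp_integrable (M : ℕ) [NeZero M] (w : ZMod M → ℝ) (c : ℝ) (μ : Measure ℝ)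
    [IsProbabilityMeasure μ] : Integrable (fun y => interp M w (c + y)) μ := by
  unfold interp
  exact integrable_finsetSum _ fun k _ => (hatFn_integrable M k _ _).const_mul _

lemma interp_sub_le (M : ℕ) [NeZero M] (hM : 2 ≤ M) (v w : ZMod M → ℝ) (E : ℝ)
    (h : ∀ k, |v k - w k| ≤ E) (x : ℝ) : |interp M v x - interp M w x| ≤ E := by
  rw [interp_eq M hM, interp_eq M hM]
  have ht0 : 0 ≤ Int.fract (M * x) := Int.fract_nonneg _
  have ht1 : Int.fract (M * x) < 1 := Int.fract_lt_one _
  have h1 := abs_le.1 (h ((⌊M * x⌋ : ℤ) : ZMod M))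
  have h2 := abs_le.1 (h ((⌊M * x⌋ + 1 : ℤ) : ZMod M))
  rw [abs_le]
  constructor <;> nlinarith

lemma semigroup {f : ℝ → ℝ} {B : ℝ} (hc : Continuous f) (hB : ∀ x, |f x| ≤ B) (δ : ℝ) (hδ : 0 ≤ δ)
    (n : ℕ) (x : ℝ) :
    ∫ y, f (x + y) ∂(gaussianReal 0 (((n + 1 : ℕ) : ℝ) * δ).toNNReal)
      = ∫ z, ∫ y, f (x + z + y) ∂(gaussianReal 0 ((n : ℝ) * δ).toNNReal)
          ∂(gaussianReal 0 δ.toNNReal) := by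
  have e : (((n + 1 : ℕ) : ℝ) * δ).toNNReal = δ.toNNReal + ((n : ℝ) * δ).toNNReal := by
    rw [← Real.toNNReal_add hδ (by positivity)]; congr 1; push_cast; ring
  have c := gaussianReal_conv_gaussianReal (m₁ := 0) (m₂ := 0) (v₁ := δ.toNNReal)
    (v₂ := ((n : ℝ) * δ).toNNReal)
  rw [add_zero] at c
  rw [e, ← c, integral_conv]
  · simp only [add_assoc]
  · rw [c]; exact shift_integrable hc hB x _

/-- Deterministic part of the error (Theorem 2.2, estimate (2.3)): if `u₀` is 1-periodic
of class `C²` and `u(t,x) = ∫ u₀(x + y) dγ_t(y)` solves the heat equation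
`∂ₜu = (1/2)∂ₓₓu`, then for every `T > 0` there is `C > 0` such that, with `δt = T/M_T`,
`δx = 1/M` and `vⁿ = Qⁿ (u₀(x_j))_j`, for all `0 ≤ n ≤ M_T`,
`max_j |u(nδt, x_j) - vⁿ_j| ≤ C (δx²/δt) sup_{x ∈ [0,1]} |u₀''(x)|`. -/
theorem deterministic_error (u₀ : ℝ → ℝ) (hper : Function.Periodic u₀ 1)
    (hC2 : ContDiff ℝ 2 u₀) (T : ℝ) (hT : 0 < T) : ∃ C : ℝ, 0 < C ∧
    ∀ (MT : ℕ), 1 ≤ MT → ∀ (M : ℕ) [NeZero M], 2 ≤ M →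
    ∀ (n : ℕ), n ≤ MT → ∀ j : ZMod M,
      |(∫ y, u₀ ((j.val : ℝ) / M + y) ∂(gaussianReal 0 ((n : ℝ) * (T / MT)).toNNReal))
          - ((Qmat M (T / MT) ^ n).mulVec (fun k : ZMod M => u₀ ((k.val : ℝ) / M))) j|
        ≤ C * ((1 / M : ℝ) ^ 2 / (T / MT))
            * ⨆ x : Set.Icc (0:ℝ) 1, |iteratedDeriv 2 u₀ x| := by
  refine ⟨T, hT, ?_⟩
  intro MT hMT M _ hM
  set K := ⨆ x : Set.Icc (0:ℝ) 1, |iteratedDeriv 2 u₀ x| with hKdef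
  have hc := hC2.continuous
  have hc2 : Continuous (iteratedDeriv 2 u₀) := hC2.continuous_iteratedDeriv 2 (by norm_num)
  have hK0 : 0 ≤ K := Real.iSup_nonneg fun _ => abs_nonneg _
  have hred : ∀ x : ℝ, ∃ y ∈ Set.Icc (0:ℝ) 1, ∃ m : ℤ, x = y + m := fun x =>
    ⟨Int.fract x, ⟨Int.fract_nonneg x, (Int.fract_lt_one x).le⟩, ⌊x⌋, (Int.fract_add_floor x).symm⟩
  have hbdd : BddAbove (Set.range fun x : Set.Icc (0:ℝ) 1 => |iteratedDeriv 2 u₀ x|) :=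
    (isCompact_range (by fun_prop)).bddAbove
  have hK : ∀ x, |iteratedDeriv 2 u₀ x| ≤ K := by
    intro x
    obtain ⟨y, hy, m, rfl⟩ := hred x
    have e : (fun z => u₀ (z + m)) = u₀ := by
      funext z; simpa using hper.int_mul m z
    have := congrFun (iteratedDeriv_comp_add_const 2 u₀ (m : ℝ)) y
    rw [e] at this
    rw [← this]
    exact le_ciSup hbdd ⟨y, hy⟩
  obtain ⟨B, hB⟩ : ∃ B, ∀ x, |u₀ x| ≤ B := by
    obtain ⟨B, hB⟩ := isCompact_Icc.exists_bound_of_continuousOn (s := Set.Icc (0:ℝ) 1)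
      hc.continuousOn
    refine ⟨B, fun x => ?_⟩
    obtain ⟨y, hy, m, rfl⟩ := hred x
    have : u₀ (y + m) = u₀ y := by simpa using hper.int_mul m y
    rw [this]; exact hB y hy
  have hq := quad_of_c2 u₀ hC2 K hK
  have hδ : 0 < T / MT := by
    have : (0:ℝ) < MT := by exact_mod_cast hMT
    positivity
  have main : ∀ n : ℕ, ∀ j : ZMod M,
      |(∫ y, u₀ ((j.val : ℝ) / M + y) ∂(gaussianReal 0 ((n : ℝ) * (T / MT)).toNNReal))
          - ((Qmat M (T / MT) ^ n).mulVec (fun k : ZMod M => u₀ ((k.val : ℝ) / M))) j|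
        ≤ n * (K * (1 / M : ℝ) ^ 2) := by
    intro n
    induction n with
    | zero => intro j; simp [gaussianReal_zero_var]
    | succ n ih =>
      intro j
      rw [pow_succ', ← Matrix.mulVec_mulVec, Q_mulVec, semigroup hc hB _ hδ.le]
      set μ := gaussianReal 0 ((n : ℝ) * (T / MT)).toNNReal
      set w := (Qmat M (T / MT) ^ n).mulVec (fun k : ZMod M => u₀ ((k.val : ℝ) / M))
      set U : ℝ → ℝ := fun x => ∫ y, u₀ (x + y) ∂μ with hU
      have hUc : Continuous U := avg_cont hc hB μ
      have hUB : ∀ x, |U x| ≤ B := fun x => abs_avg_le (fun y => hB _) μ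
      have hUp : Function.Periodic U 1 := avg_per hper μ
      have hUq : QuadBd K U := avg_quad hc hB hq μ
      change |∫ z, U ((j.val : ℝ) / M + z) ∂_ - _| ≤ _
      rw [← integral_sub (shift_integrable hUc hUB _ _) (interp_integrable M w _ _)]
      refine abs_avg_le (fun z => ?_) _
      have h1 := interp_err M hM K hK0 U hUp hUq ((j.val : ℝ) / M + z)
      have h2 := interp_sub_le M hM (fun k => U ((k.val : ℝ) / M)) w _ ih ((j.val : ℝ) / M + z)
      refine (abs_sub_le _ _ _).trans ((add_le_add h1 h2).trans (le_of_eq ?_))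
      push_cast; ring
  intro n hn j
  refine (main n j).trans ?_
  have hn' : (n : ℝ) ≤ MT := by exact_mod_cast hn
  have hMT0 : (0:ℝ) < MT := by exact_mod_cast hMT
  have e : T * ((1 / M : ℝ) ^ 2 / (T / MT)) * K = MT * (K * (1 / M : ℝ) ^ 2) := by
    field_simp
  rw [e]
  gcongr
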